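/- arXiv:1201.5753 — 3 statements merged into one kernel-verified Lean document; each statement's English description precedes it below -/
import Mathlib

section
/- Ladyzhenskaya's inequality in the plane: for every continuously differentiable function φ : ℝ² → ℝ with compact support, one has ∫_{ℝ²} φ(x)⁴ dx ≤ 2 · (∫_{ℝ²} φ(x)² dx) · (∫_{ℝ²} ‖∇φ(x)‖² dx). -/
open MeasureTheory

/-- Cauchy-Schwarz for integrals of continuous compactly supported functions. -/
lemma lady_cs (f g : ℝ × ℝ → ℝ) (h1 : Integrable (fun x => f x ^ 2))
    (h2 : Integrable (fun x => |f x * g x|)) (h3 : Integrable (fun x => g x ^ 2)) :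
    (∫ x, |f x * g x|) ^ 2 ≤ (∫ x, f x ^ 2) * ∫ x, g x ^ 2 := by
  have key : ∀ t : ℝ, 0 ≤ (∫ x, f x ^ 2) * (t * t) + (-2 * ∫ x, |f x * g x|) * t
      + ∫ x, g x ^ 2 := by
    intro t
    have h : 0 ≤ ∫ x, (t * |f x| - |g x|) ^ 2 := integral_nonneg fun x => sq_nonneg _
    have e : (fun x => (t * |f x| - |g x|) ^ 2)
        = fun x => ((t * t) * f x ^ 2 + (-2 * t) * |f x * g x|) + g x ^ 2 := by
      funext x
      rw [abs_mul, ← sq_abs (f x), ← sq_abs (g x)]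
      ring
    have h12 : Integrable (fun x => (t * t) * f x ^ 2 + (-2 * t) * |f x * g x|) :=
      (h1.const_mul _).add (h2.const_mul _)
    rw [e, integral_add h12 h3,
      integral_add (h1.const_mul _) (h2.const_mul _), integral_const_mul,
      integral_const_mul] at h
    linarith
  have := discrim_le_zero key
  unfold discrim at this
  linarith

/-- One-dimensional bound. -/
lemma lady_one (f : ℝ → ℝ) (hf : ContDiff ℝ 1 f) (hs : HasCompactSupport f) (b : ℝ) :
    f b ^ 2 ≤ 2 * ∫ x, |f x * deriv f x| := by
  have hf2 : ContDiff ℝ 1 (fun x => f x ^ 2) := hf.pow 2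
  have hs2 : HasCompactSupport (fun x => f x ^ 2) :=
    hs.comp_left (g := fun y : ℝ => y ^ 2) (by simp)
  have h := hs2.integral_Iic_deriv_eq hf2 b
  have hd : deriv (fun x => f x ^ 2) = fun x => 2 * (f x * deriv f x) := by
    funext x
    have := ((hf.differentiable (by simp)) x).hasDerivAt.pow 2
    rw [show (fun x => f x ^ 2) = f ^ 2 from rfl, this.deriv]
    simp; ring
  have hc : Continuous (fun x => f x * deriv f x) :=
    hf.continuous.mul (hf.continuous_deriv (by simp))
  have hi : Integrable (fun x => f x * deriv f x) :=
    hc.integrable_of_hasCompactSupport hs.mul_right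
  rw [hd, integral_const_mul] at h
  rw [← h]
  gcongr
  calc _ ≤ ∫ x in Set.Iic b, |f x * deriv f x| :=
        integral_mono hi.integrableOn hi.abs.integrableOn fun x => le_abs_self _
    _ ≤ _ := setIntegral_le_integral hi.abs (Filter.Eventually.of_forall fun x => abs_nonneg _)

/-- Ladyzhenskaya's inequality in the plane: for every continuously differentiable
function `φ : ℝ² → ℝ` with compact support,
`∫ φ⁴ ≤ 2 * (∫ φ²) * (∫ ‖∇φ‖²)`, where `‖∇φ x‖² = (∂₁φ x)² + (∂₂φ x)²`. -/
theorem ladyzhenskaya_plane (φ : ℝ × ℝ → ℝ)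
    (hφ : ContDiff ℝ 1 φ) (hsupp : HasCompactSupport φ) :
    ∫ x : ℝ × ℝ, φ x ^ 4 ≤
      2 * (∫ x : ℝ × ℝ, φ x ^ 2) *
        ∫ x : ℝ × ℝ, (fderiv ℝ φ x (1, 0)) ^ 2 + (fderiv ℝ φ x (0, 1)) ^ 2 := by
  have hcφ := hφ.continuous
  have hcd : ∀ v, Continuous fun x => fderiv ℝ φ x v := fun v =>
    (hφ.continuous_fderiv (by simp)).clm_apply continuous_const
  have hsd : ∀ v, HasCompactSupport fun x => fderiv ℝ φ x v := fun v =>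
    (hsupp.fderiv ℝ).comp_left (g := fun L : ℝ × ℝ →L[ℝ] ℝ => L v) (by simp)
  have hpow : ∀ (u : ℝ × ℝ → ℝ) (n : ℕ), n ≠ 0 → Continuous u → HasCompactSupport u →
      Integrable (fun x => u x ^ n) := fun u n hn h1 h2 =>
    (h1.pow n).integrable_of_hasCompactSupport
      (h2.comp_left (g := fun y : ℝ => y ^ n) (by simp [hn]))
  have hmix : ∀ v, Integrable (fun x => |φ x * fderiv ℝ φ x v|) := fun v =>
    ((hcφ.mul (hcd v)).integrable_of_hasCompactSupport (hsupp.mul_right)).abs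
  have hdiff := hφ.differentiable (by simp)
  have hA : ∀ x y, φ (x, y) ^ 2 ≤ 2 * ∫ s, |φ (s, y) * fderiv ℝ φ (s, y) (1, 0)| := by
    intro x y
    have hs : HasCompactSupport fun s => φ (s, y) := by
      refine HasCompactSupport.intro (hsupp.isCompact.image continuous_fst) fun s hs => ?_
      by_contra h
      exact hs ⟨(s, y), subset_tsupport _ h, rfl⟩
    have h := lady_one (fun s => φ (s, y)) (hφ.comp (contDiff_id.prodMk contDiff_const)) hs x
    have hd : ∀ s, deriv (fun s => φ (s, y)) s = fderiv ℝ φ (s, y) (1, 0) := fun s =>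
      ((hdiff (s, y)).hasFDerivAt.comp_hasDerivAt s
        ((hasDerivAt_id s).prodMk (hasDerivAt_const s y))).deriv
    simpa only [hd] using h
  have hB : ∀ x y, φ (x, y) ^ 2 ≤ 2 * ∫ s, |φ (x, s) * fderiv ℝ φ (x, s) (0, 1)| := by
    intro x y
    have hs : HasCompactSupport fun s => φ (x, s) := by
      refine HasCompactSupport.intro (hsupp.isCompact.image continuous_snd) fun s hs => ?_
      by_contra h
      exact hs ⟨(x, s), subset_tsupport _ h, rfl⟩
    have h := lady_one (fun s => φ (x, s)) (hφ.comp (contDiff_const.prodMk contDiff_id)) hs y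
    have hd : ∀ s, deriv (fun s => φ (x, s)) s = fderiv ℝ φ (x, s) (0, 1) := fun s =>
      ((hdiff (x, s)).hasFDerivAt.comp_hasDerivAt s
        ((hasDerivAt_const s x).prodMk (hasDerivAt_id s))).deriv
    simpa only [hd] using h
  have hm1 := hmix (1, 0)
  have hm2 := hmix (0, 1)
  rw [Measure.volume_eq_prod] at hm1 hm2
  have hIA := (hm1.integral_prod_right).const_mul 2
  have hIB := (hm2.integral_prod_left).const_mul 2
  have main : ∫ x, φ x ^ 4 ≤ (2 * ∫ x, |φ x * fderiv ℝ φ x (0, 1)|) *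
      (2 * ∫ x, |φ x * fderiv ℝ φ x (1, 0)|) := by
    have h4 := hpow φ 4 (by simp) hcφ hsupp
    rw [Measure.volume_eq_prod] at h4 ⊢
    rw [integral_prod _ hm2, integral_prod_symm _ hm1, ← integral_const_mul,
      ← integral_const_mul, ← integral_prod_mul]
    refine integral_mono h4 (hIB.mul_prod hIA) ?_
    rintro ⟨x, y⟩
    have e : φ (x, y) ^ 4 = φ (x, y) ^ 2 * φ (x, y) ^ 2 := by ring
    simp only [e]
    exact mul_le_mul (hB x y) (hA x y) (sq_nonneg _) ((sq_nonneg _).trans (hB x y))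
  have i2 := hpow φ 2 (by simp) hcφ hsupp
  have j1 := hpow _ 2 (by simp) (hcd (1, 0)) (hsd _)
  have j2 := hpow _ 2 (by simp) (hcd (0, 1)) (hsd _)
  have c1 := lady_cs φ _ i2 (hmix (1, 0)) j1
  have c2 := lady_cs φ _ i2 (hmix (0, 1)) j2
  rw [integral_add j1 j2]
  nlinarith [sq_nonneg ((∫ x, |φ x * fderiv ℝ φ x (0, 1)|) - ∫ x, |φ x * fderiv ℝ φ x (1, 0)|)]
end

section
/- Sharper form of Ladyzhenskaya's inequality obtained in the proof: for every continuously differentiable function φ : ℝ² → ℝ with compact support, ∫_{ℝ²} φ⁴ dx ≤ 4 · (∫_{ℝ²} φ² dx) · (∫_{ℝ²} (∂₁φ)² dx)^{1/2} · (∫_{ℝ²} (∂₂φ)² dx)^{1/2}. -/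
open MeasureTheory

lemma sq_le_integral_aux (g : ℝ → ℝ) (hg : ContDiff ℝ 1 g) (hs : HasCompactSupport g) (x : ℝ) :
    g x ^ 2 ≤ ∫ s, 2 * (|g s| * |deriv g s|) := by
  have h2 : ContDiff ℝ 1 (fun s => g s ^ 2) := hg.pow 2
  have hs2 : HasCompactSupport (fun s => g s ^ 2) :=
    hs.comp_left (g := fun t : ℝ => t ^ 2) (by simp)
  have hd : deriv (fun s => g s ^ 2) = fun s => 2 * (g s * deriv g s) := by
    funext s
    have := ((hg.differentiable one_ne_zero s).hasDerivAt.pow 2).deriv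
    simp only [Pi.pow_def] at this
    rw [this]; push_cast; ring
  have hc : Continuous (fun s => 2 * (|g s| * |deriv g s|)) := by
    have := hg.continuous_deriv le_rfl
    have := hg.continuous
    fun_prop
  have hcs : HasCompactSupport (fun s => 2 * (|g s| * |deriv g s|)) := by
    refine hs.mono ?_
    intro s hs'
    simp only [Function.mem_support] at *
    intro h0; apply hs'; simp [h0]
  have hint : Integrable (fun s => 2 * (|g s| * |deriv g s|)) := hc.integrable_of_hasCompactSupport hcs
  have e := HasCompactSupport.integral_Iic_deriv_eq h2 hs2 x
  calc g x ^ 2 = ∫ s in Set.Iic x, deriv (fun s => g s ^ 2) s := e.symm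
    _ ≤ ‖∫ s in Set.Iic x, deriv (fun s => g s ^ 2) s‖ := le_abs_self _
    _ ≤ ∫ s in Set.Iic x, ‖deriv (fun s => g s ^ 2) s‖ := norm_integral_le_integral_norm _
    _ = ∫ s in Set.Iic x, 2 * (|g s| * |deriv g s|) := by
        rw [hd]; simp
    _ ≤ _ := setIntegral_le_integral hint (Filter.Eventually.of_forall fun s => by positivity)

lemma cs_aux (f g : ℝ × ℝ → ℝ) (hf : Continuous f) (hg : Continuous g)
    (hfs : HasCompactSupport f) (hgs : HasCompactSupport g) :
    ∫ x, |f x| * |g x| ≤ Real.sqrt (∫ x, f x ^ 2) * Real.sqrt (∫ x, g x ^ 2) := by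
  have h := integral_mul_le_Lp_mul_Lq_of_nonneg (μ := (volume : Measure (ℝ × ℝ)))
    (f := fun x => |f x|) (g := fun x => |g x|) Real.HolderConjugate.two_two
    (Filter.Eventually.of_forall fun s => abs_nonneg _)
    (Filter.Eventually.of_forall fun s => abs_nonneg _)
    (hf.abs.memLp_of_hasCompactSupport (hfs.comp_left (g := fun t : ℝ => |t|) (by simp)))
    (hg.abs.memLp_of_hasCompactSupport (hgs.comp_left (g := fun t : ℝ => |t|) (by simp)))
  simpa [Real.sqrt_eq_rpow] using h

/-- Sharper form of Ladyzhenskaya's inequality: for every continuously differentiable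
function `φ : ℝ² → ℝ` with compact support,
`∫ φ⁴ ≤ 4 * (∫ φ²) * (∫ (∂₁φ)²)^(1/2) * (∫ (∂₂φ)²)^(1/2)`. -/
theorem ladyzhenskaya_sharp (φ : ℝ × ℝ → ℝ)
    (hφ : ContDiff ℝ 1 φ) (hsupp : HasCompactSupport φ) :
    ∫ x : ℝ × ℝ, φ x ^ 4 ≤
      4 * (∫ x : ℝ × ℝ, φ x ^ 2) *
        Real.sqrt (∫ x : ℝ × ℝ, (fderiv ℝ φ x (1, 0)) ^ 2) *
        Real.sqrt (∫ x : ℝ × ℝ, (fderiv ℝ φ x (0, 1)) ^ 2) := by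
  have hc : Continuous φ := hφ.continuous
  have hcd : ∀ v, Continuous (fun x => fderiv ℝ φ x v) := fun v =>
    (hφ.continuous_fderiv one_ne_zero).clm_apply continuous_const
  have hsd : ∀ v, HasCompactSupport (fun x => fderiv ℝ φ x v) := fun v =>
    hsupp.fderiv_apply (𝕜 := ℝ) v
  have hI : ∀ v, Integrable (fun x => 2 * (|φ x| * |fderiv ℝ φ x v|)) := by
    intro v
    refine Continuous.integrable_of_hasCompactSupport ?_ ?_
    · have := hcd v
      fun_prop
    · refine hsupp.mono ?_
      intro s hs'
      simp only [Function.mem_support] at *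
      intro h0; apply hs'; simp [h0]
  have h1 : ∀ x y, φ (x, y) ^ 2 ≤ ∫ s, 2 * (|φ (s, y)| * |fderiv ℝ φ (s, y) (1, 0)|) := by
    intro x y
    have hd : ∀ s, deriv (fun s => φ (s, y)) s = fderiv ℝ φ (s, y) (1, 0) := fun s =>
      ((hφ.differentiable one_ne_zero (s, y)).hasFDerivAt.comp_hasDerivAt s
        ((hasDerivAt_id s).prodMk (hasDerivAt_const s y))).deriv
    have := sq_le_integral_aux (fun s => φ (s, y)) (by fun_prop)
      (hsupp.comp_isClosedEmbedding (Function.LeftInverse.isClosedEmbedding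
        (f := Prod.fst) (g := fun s : ℝ => (s, y)) (fun _ => rfl) (by fun_prop) (by fun_prop))) x
    simpa only [hd] using this
  have h2 : ∀ x y, φ (x, y) ^ 2 ≤ ∫ t, 2 * (|φ (x, t)| * |fderiv ℝ φ (x, t) (0, 1)|) := by
    intro x y
    have hd : ∀ s, deriv (fun s => φ (x, s)) s = fderiv ℝ φ (x, s) (0, 1) := fun s =>
      ((hφ.differentiable one_ne_zero (x, s)).hasFDerivAt.comp_hasDerivAt s
        ((hasDerivAt_const s x).prodMk (hasDerivAt_id s))).deriv
    have := sq_le_integral_aux (fun s => φ (x, s)) (by fun_prop)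
      (hsupp.comp_isClosedEmbedding (Function.LeftInverse.isClosedEmbedding
        (f := Prod.snd) (g := fun s : ℝ => (x, s)) (fun _ => rfl) (by fun_prop) (by fun_prop))) y
    simpa only [hd] using this
  set F : ℝ → ℝ := fun y => ∫ s, 2 * (|φ (s, y)| * |fderiv ℝ φ (s, y) (1, 0)|) with hF
  set G : ℝ → ℝ := fun x => ∫ t, 2 * (|φ (x, t)| * |fderiv ℝ φ (x, t) (0, 1)|) with hG
  have iF : Integrable F := (hI (1, 0)).integral_prod_right
  have iG : Integrable G := (hI (0, 1)).integral_prod_left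
  have eF : ∫ y, F y = 2 * ∫ x, |φ x| * |fderiv ℝ φ x (1, 0)| := by
    rw [← integral_const_mul]; exact (integral_prod_symm _ (hI (1, 0))).symm
  have eG : ∫ y, G y = 2 * ∫ x, |φ x| * |fderiv ℝ φ x (0, 1)| := by
    rw [← integral_const_mul]; exact (integral_prod _ (hI (0, 1))).symm
  have key : ∫ x : ℝ × ℝ, φ x ^ 4 ≤ ∫ z : ℝ × ℝ, G z.1 * F z.2 := by
    refine integral_mono_of_nonneg (Filter.Eventually.of_forall fun s => by positivity)
      (iG.mul_prod iF) (Filter.Eventually.of_forall ?_)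
    rintro ⟨x, y⟩
    have a := h1 x y
    have b := h2 x y
    calc φ (x, y) ^ 4 = φ (x, y) ^ 2 * φ (x, y) ^ 2 := by ring
      _ ≤ G x * F y := mul_le_mul b a (sq_nonneg _) ((sq_nonneg _).trans b)
  have e : ∫ z : ℝ × ℝ, G z.1 * F z.2 = (∫ x, G x) * ∫ y, F y := integral_prod_mul G F
  rw [e, eF, eG] at key
  have c1 := cs_aux φ _ hc (hcd (1, 0)) hsupp (hsd (1, 0))
  have c2 := cs_aux φ _ hc (hcd (0, 1)) hsupp (hsd (0, 1))
  have n1 : 0 ≤ ∫ x, |φ x| * |fderiv ℝ φ x (1, 0)| := integral_nonneg fun _ => by positivity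
  have m := mul_le_mul c2 c1 n1 (by positivity)
  have sq : Real.sqrt (∫ x, φ x ^ 2) * Real.sqrt (∫ x, φ x ^ 2) = ∫ x, φ x ^ 2 :=
    Real.mul_self_sqrt (integral_nonneg fun _ => by positivity)
  rw [← sq]
  linarith
end

section
/- Smoothing estimate for differences of trajectories (abstract form of the verification of assumption (A6)): let l > 0, ν > 0, K ≥ 0, C₁ ≥ 1, C₂ ≥ 0. Let y : [0,2l] → [0,∞) be continuous and z : [0,2l] → [0,∞) be integrable, and assume: (i) y(τ) ≤ C₁ y(s) whenever 0 ≤ s ≤ τ ≤ 2l; (ii) ∫_0^{2l} z(τ) dτ ≤ C₂; (iii) for every s ∈ [0,l], (ν/2) ∫_s^{2l} z(τ) dτ ≤ K ∫_s^{2l} z(τ) y(τ) dτ + y(s). Then ∫_l^{2l} z(τ) dτ ≤ (C₃/l) ∫_0^l y(s) ds, where C₃ = (2/ν)(K C₁ C₂ + 1). -/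
open MeasureTheory intervalIntegral

/-- Smoothing estimate for differences of trajectories (abstract form of the
verification of assumption (A6)): under (i) `y(τ) ≤ C₁ y(s)` for `s ≤ τ`,
(ii) `∫_0^{2l} z ≤ C₂`, and (iii) the energy-type inequality
`(ν/2) ∫_s^{2l} z ≤ K ∫_s^{2l} z y + y(s)` for `s ∈ [0,l]`, one has
`∫_l^{2l} z ≤ (C₃/l) ∫_0^l y` with `C₃ = (2/ν)(K C₁ C₂ + 1)`. -/
theorem trajectory_smoothing_estimate (l ν K C₁ C₂ : ℝ)
    (hl : 0 < l) (hν : 0 < ν) (hK : 0 ≤ K) (hC₁ : 1 ≤ C₁) (hC₂ : 0 ≤ C₂)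
    (y z : ℝ → ℝ)
    (hy_cont : ContinuousOn y (Set.Icc 0 (2 * l)))
    (hy_nonneg : ∀ t ∈ Set.Icc 0 (2 * l), 0 ≤ y t)
    (hz_int : IntervalIntegrable z volume 0 (2 * l))
    (hz_nonneg : ∀ t ∈ Set.Icc 0 (2 * l), 0 ≤ z t)
    (hi : ∀ s ∈ Set.Icc 0 (2 * l), ∀ τ ∈ Set.Icc 0 (2 * l), s ≤ τ → y τ ≤ C₁ * y s)
    (hii : ∫ τ in (0:ℝ)..(2 * l), z τ ≤ C₂)
    (hiii : ∀ s ∈ Set.Icc 0 l,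
      (ν / 2) * ∫ τ in s..(2 * l), z τ ≤
        K * (∫ τ in s..(2 * l), z τ * y τ) + y s) :
    ∫ τ in l..(2 * l), z τ ≤
      ((2 / ν) * (K * C₁ * C₂ + 1) / l) * ∫ s in (0:ℝ)..l, y s := by
  have hsub : ∀ a b : ℝ, 0 ≤ a → a ≤ b → b ≤ 2 * l →
      Set.uIcc a b ⊆ Set.uIcc 0 (2 * l) := by
    intro a b ha hab hb
    rw [Set.uIcc_of_le hab, Set.uIcc_of_le (by linarith)]
    exact Set.Icc_subset_Icc ha hb
  have hzi : ∀ a b : ℝ, 0 ≤ a → a ≤ b → b ≤ 2 * l → IntervalIntegrable z volume a b :=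
    fun a b ha hab hb => hz_int.mono_set (hsub a b ha hab hb)
  have hz0 : ∀ a b : ℝ, 0 ≤ a → a ≤ b → b ≤ 2 * l → 0 ≤ ∫ τ in a..b, z τ :=
    fun a b ha hab hb => intervalIntegral.integral_nonneg hab
      (fun t ht => hz_nonneg t ⟨ha.trans ht.1, ht.2.trans hb⟩)
  have key : ∀ s ∈ Set.Icc 0 l,
      (∫ τ in l..(2 * l), z τ) ≤ (2 / ν) * (K * C₁ * C₂ + 1) * y s := by
    intro s hs
    have h2 : s ≤ 2 * l := by linarith [hs.2]
    have hys := hy_nonneg s ⟨hs.1, h2⟩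
    have e1 := integral_add_adjacent_intervals (hzi s l hs.1 hs.2 (by linarith))
      (hzi l (2 * l) hl.le (by linarith) le_rfl)
    have e2 := integral_add_adjacent_intervals (hzi 0 s le_rfl hs.1 h2)
      (hzi s (2 * l) hs.1 h2 le_rfl)
    have n1 := hz0 s l hs.1 hs.2 (by linarith)
    have n2 := hz0 0 s le_rfl hs.1 h2
    have hzy : IntervalIntegrable (fun τ => z τ * y τ) volume s (2 * l) := by
      apply (hzi s (2 * l) hs.1 h2 le_rfl).mul_continuousOn
      rw [Set.uIcc_of_le h2]
      exact hy_cont.mono (Set.Icc_subset_Icc_left hs.1)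
    have m : (∫ τ in s..(2 * l), z τ * y τ) ≤ ∫ τ in s..(2 * l), z τ * (C₁ * y s) := by
      apply intervalIntegral.integral_mono_on h2 hzy
        ((hzi s (2 * l) hs.1 h2 le_rfl).mul_const _)
      intro t ht
      exact mul_le_mul_of_nonneg_left (hi s ⟨hs.1, h2⟩ t ⟨hs.1.trans ht.1, ht.2⟩ ht.1)
        (hz_nonneg t ⟨hs.1.trans ht.1, ht.2⟩)
    rw [intervalIntegral.integral_mul_const] at m
    have m2 : (∫ τ in s..(2 * l), z τ) * (C₁ * y s) ≤ C₂ * (C₁ * y s) :=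
      mul_le_mul_of_nonneg_right (by linarith) (mul_nonneg (by linarith) hys)
    have m3 := mul_le_mul_of_nonneg_left (m.trans m2) hK
    have m4 := hiii s hs
    have m5 : (ν / 2) * (∫ τ in l..(2 * l), z τ) ≤ (ν / 2) * ∫ τ in s..(2 * l), z τ :=
      mul_le_mul_of_nonneg_left (by linarith) (by linarith)
    have m6 : (ν / 2) * (∫ τ in l..(2 * l), z τ) ≤ (K * C₁ * C₂ + 1) * y s := by
      linarith
    have m7 := mul_le_mul_of_nonneg_left m6 (show 0 ≤ 2 / ν by positivity)
    calc (∫ τ in l..(2 * l), z τ) = 2 / ν * ((ν / 2) * (∫ τ in l..(2 * l), z τ)) := by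
          field_simp
      _ ≤ _ := m7
      _ = _ := by ring
  have hyi : IntervalIntegrable y volume 0 l := by
    apply ContinuousOn.intervalIntegrable
    rw [Set.uIcc_of_le hl.le]
    exact hy_cont.mono (Set.Icc_subset_Icc_right (by linarith))
  have fin := intervalIntegral.integral_mono_on hl.le
    (intervalIntegrable_const (c := ∫ τ in l..(2 * l), z τ)) (hyi.const_mul _) key
  rw [intervalIntegral.integral_const, intervalIntegral.integral_const_mul, sub_zero,
    smul_eq_mul] at fin
  rw [div_mul_eq_mul_div, le_div_iff₀ hl]
  linarith
end
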